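/- arXiv:2010.12629 — 2 statements merged into one kernel-verified Lean document; each statement's English description precedes it below -/
import Mathlib

section
/- There is a universal constant C > 0 such that for every n ≥ 2 and every total Boolean function f : {0,1}^n → {0,1}, λ(f) ≤ C · adeg(f) · log n. -/
noncomputable def specNorm {I : Type*} [Fintype I] [DecidableEq I] (A : Matrix I I ℝ) : ℝ :=
  ‖Matrix.toEuclideanCLM (𝕜 := ℝ) A‖

/-- Adjacency matrix of the sensitivity graph of `f`. -/
def sensAdj {I : Type*} [Fintype I] [DecidableEq I] (f : (I → Bool) → Bool) :
    Matrix (I → Bool) (I → Bool) ℝ :=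
  Matrix.of fun x y => if hammingDist x y = 1 ∧ f x ≠ f y then (1 : ℝ) else 0

/-- Spectral sensitivity `λ(f)`: the ℓ2→ℓ2 operator norm of the adjacency matrix of the
sensitivity graph of `f`. -/
noncomputable def specSens {I : Type*} [Fintype I] [DecidableEq I] (f : (I → Bool) → Bool) : ℝ :=
  specNorm (sensAdj f)

/-- Approximate degree of a Boolean function: minimum total degree of a real polynomial
approximating it pointwise to error 1/3 on the Boolean cube. -/
noncomputable def adegB {n : ℕ} (f : (Fin n → Bool) → Bool) : ℕ :=
  sInf {d | ∃ p : MvPolynomial (Fin n) ℝ, p.totalDegree = d ∧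
    ∀ x : Fin n → Bool,
      |MvPolynomial.eval (fun i => if x i then (1 : ℝ) else 0) p - (if f x then 1 else 0)| ≤ 1/3}

/-- The character of the Boolean cube indexed by `y`, as a product over coordinates. -/
def cubeChar {I : Type*} [Fintype I] (y x : I → Bool) : ℝ :=
  ∏ i, if y i && x i then (-1 : ℝ) else 1

/-- The number of coordinates equal to `true`. -/
def cubeWeight {I : Type*} [Fintype I] (y : I → Bool) : ℕ :=
  (Finset.univ.filter fun i => y i = true).card

/-- Negate the `i`-th coordinate. -/
def cubeFlip {I : Type*} [DecidableEq I] (i : I) (x : I → Bool) : I → Bool :=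
  Function.update x i (!x i)

lemma cubeFlip_cubeFlip {I : Type*} [DecidableEq I] (i : I) (x : I → Bool) :
    cubeFlip i (cubeFlip i x) = x := by
  simp [cubeFlip]

lemma cubeFlip_left_injective {I : Type*} [DecidableEq I] (x : I → Bool) :
    Function.Injective fun i => cubeFlip i x := by
  intro i j h
  by_contra hij
  have := congrFun h i
  simp [cubeFlip, Function.update_of_ne hij] at this

section Window

lemma sum_window_mul_window {N d a b : ℕ} (ha : a ≤ N) (h : a ≤ b + d) :
    ∑ s ∈ Finset.range (N + 1),
      (if s ≤ a ∧ a < s + d then (1 : ℝ) else 0) * (if b < s ∧ s ≤ b + d then 1 else 0)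
      = ((a - b : ℕ) : ℝ) := by
  have h1 : ∀ s ∈ Finset.range (N + 1),
      (if s ≤ a ∧ a < s + d then (1 : ℝ) else 0) * (if b < s ∧ s ≤ b + d then 1 else 0)
      = if s ∈ Finset.Ioc b a then 1 else 0 := by
    intro s _
    simp only [Finset.mem_Ioc]
    split_ifs <;> first | omega | simp
  rw [Finset.sum_congr rfl h1, ← Finset.sum_filter]
  have h2 : (Finset.range (N + 1)).filter (fun s => s ∈ Finset.Ioc b a) = Finset.Ioc b a := by
    ext s
    simp only [Finset.mem_filter, Finset.mem_range, Finset.mem_Ioc]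
    omega
  rw [h2]
  simp

lemma sum_lower_window_le (N d a : ℕ) :
    ∑ s ∈ Finset.range (N + 1), (if s ≤ a ∧ a < s + d then (1 : ℝ) else 0) ≤ d := by
  rw [← Finset.sum_filter, Finset.sum_const, nsmul_one]
  have : ((Finset.range (N + 1)).filter fun s => s ≤ a ∧ a < s + d) ⊆ Finset.Ioc (a - d) a ∪
      (if a < d then {0} else ∅) := by
    intro s hs
    simp only [Finset.mem_filter, Finset.mem_range] at hs
    split_ifs <;> simp only [Finset.mem_union, Finset.mem_Ioc, Finset.mem_singleton,
      Finset.notMem_empty, or_false] <;> omega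
  have h2 := (Finset.card_le_card this).trans (Finset.card_union_le _ _)
  have h3 : (Finset.Ioc (a - d) a).card + (if a < d then ({0} : Finset ℕ) else ∅).card ≤ d := by
    rw [Nat.card_Ioc]
    split_ifs <;> simp <;> omega
  exact_mod_cast h2.trans h3

lemma sum_upper_window_le (N d b : ℕ) :
    ∑ s ∈ Finset.range (N + 1), (if b < s ∧ s ≤ b + d then (1 : ℝ) else 0) ≤ d := by
  rw [← Finset.sum_filter, Finset.sum_const, nsmul_one]
  have : ((Finset.range (N + 1)).filter fun s => b < s ∧ s ≤ b + d) ⊆ Finset.Ioc b (b + d) := by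
    intro s hs
    simp only [Finset.mem_filter, Finset.mem_Ioc] at hs ⊢
    omega
  have h2 := Finset.card_le_card this
  rw [Nat.card_Ioc] at h2
  have h3 : b + d - b = d := by omega
  rw [h3] at h2
  exact_mod_cast h2

lemma sum_sq_window_le {V : Type*} [Fintype V] {N d : ℕ} (w : ℕ → V → ℝ)
    (hw : ∀ s y, w s y = 0 ∨ w s y = 1)
    (hsum : ∀ y, ∑ s ∈ Finset.range (N + 1), w s y ≤ d) (α : V → ℝ) :
    ∑ s ∈ Finset.range (N + 1), ∑ y, (w s y * α y) ^ 2 ≤ d * ∑ y, α y ^ 2 := by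
  rw [Finset.sum_comm, Finset.mul_sum]
  refine Finset.sum_le_sum fun y _ => ?_
  have : ∀ s ∈ Finset.range (N + 1), (w s y * α y) ^ 2 = w s y * α y ^ 2 := by
    intro s _
    rcases hw s y with h | h <;> rw [h] <;> ring
  rw [Finset.sum_congr rfl this, ← Finset.sum_mul]
  exact mul_le_mul_of_nonneg_right (hsum y) (sq_nonneg _)

/-- Commutator bound for a banded bilinear form: multiplying the entries of a form of bandwidth `d`
by the difference of the levels costs at most a factor `2 * d`. -/
lemma banded_commutator_le {V : Type*} [Fintype V] (l : V → ℕ) (d : ℕ) (M : V → V → ℝ) (K : ℝ)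
    (hK : 0 ≤ K)
    (hband : ∀ y z, M y z ≠ 0 → l y ≤ l z + d ∧ l z ≤ l y + d)
    (hM : ∀ α β : V → ℝ, ∑ y, ∑ z, α y * M y z * β z ≤ K * (∑ y, α y ^ 2 + ∑ z, β z ^ 2))
    (α β : V → ℝ) :
    ∑ y, ∑ z, ((l y : ℝ) - l z) * (α y * M y z * β z)
      ≤ 2 * d * K * (∑ y, α y ^ 2 + ∑ z, β z ^ 2) := by
  obtain ⟨N, hN⟩ : ∃ N, ∀ y, l y ≤ N :=
    ⟨∑ y, l y, fun y => Finset.single_le_sum (fun _ _ => Nat.zero_le _) (Finset.mem_univ y)⟩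
  set w : ℕ → V → ℝ := fun s y => if s ≤ l y ∧ l y < s + d then 1 else 0 with hw
  set w' : ℕ → V → ℝ := fun s y => if l y < s ∧ s ≤ l y + d then 1 else 0 with hw'
  have key : ∑ y, ∑ z, ((l y : ℝ) - l z) * (α y * M y z * β z)
      = ∑ s ∈ Finset.range (N + 1),
        (∑ y, ∑ z, (w s y * α y) * M y z * (w' s z * β z)
          + ∑ y, ∑ z, (w' s y * -α y) * M y z * (w s z * β z)) := by
    simp only [← Finset.sum_add_distrib]
    rw [Finset.sum_comm (s := Finset.range (N + 1))]
    refine Finset.sum_congr rfl fun y _ => ?_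
    rw [Finset.sum_comm (s := Finset.range (N + 1))]
    refine Finset.sum_congr rfl fun z _ => ?_
    by_cases h0 : M y z = 0
    · simp [h0]
    obtain ⟨h1, h2⟩ := hband y z h0
    have e1 := sum_window_mul_window (hN y) h1
    have e2 := sum_window_mul_window (hN z) h2
    have e3 : (l y : ℝ) - l z = ((l y - l z : ℕ) : ℝ) - ((l z - l y : ℕ) : ℝ) := by
      rcases le_total (l y) (l z) with h | h
      · rw [Nat.sub_eq_zero_of_le h, Nat.cast_sub h]; simp
      · rw [Nat.sub_eq_zero_of_le h, Nat.cast_sub h]; simp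
    rw [e3, ← e1, ← e2, ← Finset.sum_sub_distrib, Finset.sum_mul]
    refine Finset.sum_congr rfl fun s _ => ?_
    simp only [hw, hw']
    ring
  rw [key]
  have hw01 : ∀ s y, w s y = 0 ∨ w s y = 1 := by
    intro s y; simp only [hw]; split_ifs <;> simp
  have hw01' : ∀ s y, w' s y = 0 ∨ w' s y = 1 := by
    intro s y; simp only [hw']; split_ifs <;> simp
  have b1 := fun γ : V → ℝ =>
    sum_sq_window_le (N := N) w hw01 (fun y => sum_lower_window_le N d (l y)) γ
  have b2 := fun γ : V → ℝ =>
    sum_sq_window_le (N := N) w' hw01' (fun y => sum_upper_window_le N d (l y)) γ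
  calc _ ≤ ∑ s ∈ Finset.range (N + 1),
        (K * (∑ y, (w s y * α y) ^ 2 + ∑ z, (w' s z * β z) ^ 2)
          + K * (∑ y, (w' s y * -α y) ^ 2 + ∑ z, (w s z * β z) ^ 2)) :=
        Finset.sum_le_sum fun s _ => add_le_add (hM _ _) (hM _ _)
    _ = K * (∑ s ∈ Finset.range (N + 1), ∑ y, (w s y * α y) ^ 2
          + ∑ s ∈ Finset.range (N + 1), ∑ y, (w' s y * β y) ^ 2
          + ∑ s ∈ Finset.range (N + 1), ∑ y, (w' s y * -α y) ^ 2
          + ∑ s ∈ Finset.range (N + 1), ∑ y, (w s y * β y) ^ 2) := by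
        simp only [Finset.sum_add_distrib, ← Finset.mul_sum]
        ring
    _ ≤ K * (d * ∑ y, α y ^ 2 + d * ∑ y, β y ^ 2 + d * ∑ y, (-α y) ^ 2 + d * ∑ y, β y ^ 2) :=
        mul_le_mul_of_nonneg_left
          (add_le_add (add_le_add (add_le_add (b1 α) (b2 β)) (b2 fun y => -α y)) (b1 β)) hK
    _ = _ := by simp only [neg_sq]; ring

end Window

section Cube

variable {I : Type*} [Fintype I]

lemma cubeChar_comm (x y : I → Bool) : cubeChar x y = cubeChar y x := by
  simp only [cubeChar, Bool.and_comm]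

lemma sum_cube_prod [DecidableEq I] (g : I → Bool → ℝ) :
    ∑ x : I → Bool, ∏ i, g i (x i) = ∏ i, (g i true + g i false) := by
  have h := Finset.prod_univ_sum (fun _ : I => (Finset.univ : Finset Bool)) g
  rw [Fintype.piFinset_univ] at h
  rw [← h]
  simp

lemma sum_cubeChar_mul_cubeChar [DecidableEq I] (y z : I → Bool) :
    ∑ x, cubeChar y x * cubeChar z x = if y = z then (2 : ℝ) ^ Fintype.card I else 0 := by
  simp only [cubeChar, ← Finset.prod_mul_distrib]
  rw [sum_cube_prod fun i b =>
    (if y i && b then (-1 : ℝ) else 1) * (if z i && b then (-1 : ℝ) else 1)]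
  split_ifs with h
  · subst h
    rw [Fintype.card, ← Finset.prod_const]
    refine Finset.prod_congr rfl fun i _ => ?_
    cases y i <;> norm_num
  · obtain ⟨i, hi⟩ := Function.ne_iff.mp h
    refine Finset.prod_eq_zero (Finset.mem_univ i) ?_
    revert hi
    cases y i <;> cases z i <;> norm_num

lemma cubeWeight_le_add_hammingDist (y z : I → Bool) :
    cubeWeight y ≤ cubeWeight z + hammingDist y z := by
  classical
  unfold cubeWeight hammingDist
  refine le_trans (Finset.card_le_card ?_) (Finset.card_union_le _ _)
  intro i hi
  simp only [Finset.mem_filter, Finset.mem_univ, true_and, Finset.mem_union] at hi ⊢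
  rw [hi]
  cases z i <;> simp

/-- A polynomial multiplier of degree `d` only couples characters whose indices differ in at most
`d` coordinates. -/
lemma hammingDist_le_totalDegree [DecidableEq I] (p : MvPolynomial I ℝ) (y z : I → Bool)
    (h : ∑ x : I → Bool, cubeChar y x * cubeChar z x *
      MvPolynomial.eval (fun i => if x i then (1 : ℝ) else 0) p ≠ 0) :
    hammingDist y z ≤ p.totalDegree := by
  simp only [MvPolynomial.eval_eq', Finset.mul_sum] at h
  rw [Finset.sum_comm] at h
  obtain ⟨m, hm, hne⟩ := Finset.exists_ne_zero_of_sum_ne_zero h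
  have hfac : ∑ x : I → Bool, cubeChar y x * cubeChar z x *
      (MvPolynomial.coeff m p * ∏ i, (if x i then (1 : ℝ) else 0) ^ m i)
      = MvPolynomial.coeff m p * ∑ x : I → Bool, ∏ i,
        ((if y i && x i then (-1 : ℝ) else 1) * (if z i && x i then (-1 : ℝ) else 1) *
          (if x i then (1 : ℝ) else 0) ^ m i) := by
    rw [Finset.mul_sum]
    refine Finset.sum_congr rfl fun x _ => ?_
    simp only [cubeChar, Finset.prod_mul_distrib]
    ring
  rw [hfac, sum_cube_prod fun i b =>
    ((if y i && b then (-1 : ℝ) else 1) * (if z i && b then (-1 : ℝ) else 1) *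
      (if b then (1 : ℝ) else 0) ^ m i)] at hne
  have hprod := Finset.prod_ne_zero_iff.mp (right_ne_zero_of_mul hne)
  have hsub : (Finset.univ.filter fun i => y i ≠ z i) ⊆ m.support := by
    intro i hi
    rw [Finsupp.mem_support_iff]
    intro h0
    apply hprod i (Finset.mem_univ i)
    have hyz : y i ≠ z i := (Finset.mem_filter.mp hi).2
    rw [h0]
    revert hyz
    cases y i <;> cases z i <;> norm_num
  calc hammingDist y z ≤ m.support.card := Finset.card_le_card hsub
    _ ≤ m.sum fun _ e => e := by
        rw [Finsupp.sum, Finset.card_eq_sum_ones]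
        exact Finset.sum_le_sum fun i hi => Nat.one_le_iff_ne_zero.mpr (Finsupp.mem_support_iff.mp hi)
    _ ≤ p.totalDegree := MvPolynomial.le_totalDegree hm

lemma cubeChar_cubeFlip [DecidableEq I] (y x : I → Bool) (i : I) :
    cubeChar y (cubeFlip i x) = (if y i then -1 else 1) * cubeChar y x := by
  unfold cubeChar
  rw [← Finset.mul_prod_erase _ _ (Finset.mem_univ i),
    ← Finset.mul_prod_erase (a := i) _ (fun j => if y j && x j then (-1 : ℝ) else 1)
      (Finset.mem_univ i), ← mul_assoc]
  congr 1
  · simp only [cubeFlip, Function.update_self]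
    cases y i <;> cases x i <;> norm_num
  · refine Finset.prod_congr rfl fun j hj => ?_
    rw [cubeFlip, Function.update_of_ne (Finset.ne_of_mem_erase hj)]

lemma sum_cubeChar_cubeFlip [DecidableEq I] (y x : I → Bool) :
    ∑ i, cubeChar y (cubeFlip i x)
      = ((Fintype.card I : ℝ) - 2 * cubeWeight y) * cubeChar y x := by
  simp only [cubeChar_cubeFlip, ← Finset.sum_mul]
  congr 1
  have : ∀ i ∈ (Finset.univ : Finset I), (if y i then (-1 : ℝ) else 1)
      = 1 - 2 * (if y i = true then 1 else 0) := by
    intro i _; split_ifs <;> norm_num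
  rw [Finset.sum_congr rfl this, Finset.sum_sub_distrib, ← Finset.mul_sum, Finset.sum_boole]
  simp [cubeWeight]

lemma sum_sq_sum_cubeChar [DecidableEq I] (α : (I → Bool) → ℝ) :
    ∑ x, (∑ y, α y * cubeChar y x) ^ 2 = 2 ^ Fintype.card I * ∑ y, α y ^ 2 := by
  calc _ = ∑ y, ∑ z, α y * α z * ∑ x, cubeChar y x * cubeChar z x := by
        simp_rw [sq, Finset.sum_mul_sum, Finset.mul_sum]
        rw [Finset.sum_comm]
        refine Finset.sum_congr rfl fun y _ => ?_
        rw [Finset.sum_comm]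
        refine Finset.sum_congr rfl fun z _ => Finset.sum_congr rfl fun x _ => ?_
        ring
    _ = _ := by
        simp only [sum_cubeChar_mul_cubeChar, mul_ite, mul_zero, Finset.sum_ite_eq,
          Finset.mem_univ, if_true, Finset.mul_sum]
        refine Finset.sum_congr rfl fun y _ => ?_
        ring

lemma sum_sum_cubeChar_mul [DecidableEq I] (u : (I → Bool) → ℝ) (x : I → Bool) :
    ∑ y, (∑ w, u w * cubeChar w y) * cubeChar y x = 2 ^ Fintype.card I * u x := by
  calc _ = ∑ w, u w * ∑ y, cubeChar w y * cubeChar x y := by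
        simp only [Finset.sum_mul, Finset.mul_sum]
        rw [Finset.sum_comm]
        refine Finset.sum_congr rfl fun w _ => Finset.sum_congr rfl fun y _ => ?_
        rw [cubeChar_comm x y]
        ring
    _ = _ := by
        simp only [sum_cubeChar_mul_cubeChar, mul_ite, mul_zero, Finset.sum_ite_eq',
          Finset.mem_univ, if_true]
        ring

lemma sum_cubeFlip [DecidableEq I] (i : I) (g : (I → Bool) → ℝ) :
    ∑ x, g (cubeFlip i x) = ∑ x, g x :=
  Equiv.sum_comp (Function.Involutive.toPerm (cubeFlip i) (cubeFlip_cubeFlip i)) g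

lemma sum_cubeWeight_mul [DecidableEq I] (u : (I → Bool) → ℝ) (x : I → Bool) :
    ∑ y, (cubeWeight y : ℝ) * (∑ w, u w * cubeChar w y) * cubeChar y x
      = 2 ^ Fintype.card I / 2 * (Fintype.card I * u x - ∑ i, u (cubeFlip i x)) := by
  have h : ∑ i, ∑ y, (∑ w, u w * cubeChar w y) * cubeChar y (cubeFlip i x)
      = ∑ y, (∑ w, u w * cubeChar w y) *
          (((Fintype.card I : ℝ) - 2 * cubeWeight y) * cubeChar y x) := by
    rw [Finset.sum_comm]
    simp only [← Finset.mul_sum, sum_cubeChar_cubeFlip]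
  have h2 : ∑ y, (∑ w, u w * cubeChar w y) *
        (((Fintype.card I : ℝ) - 2 * cubeWeight y) * cubeChar y x)
      = Fintype.card I * ∑ y, (∑ w, u w * cubeChar w y) * cubeChar y x
        - 2 * ∑ y, (cubeWeight y : ℝ) * (∑ w, u w * cubeChar w y) * cubeChar y x := by
    rw [Finset.mul_sum, Finset.mul_sum, ← Finset.sum_sub_distrib]
    refine Finset.sum_congr rfl fun y _ => ?_
    ring
  rw [h2] at h
  simp only [sum_sum_cubeChar_mul, ← Finset.mul_sum] at h
  linarith

lemma sum_sum_mul_cubeChar_mul [DecidableEq I] (q : (I → Bool) → ℝ) (a b : (I → Bool) → ℝ) :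
    ∑ y, ∑ z, a y * (∑ x, cubeChar y x * cubeChar z x * q x) * b z
      = ∑ x, q x * ((∑ y, a y * cubeChar y x) * ∑ z, b z * cubeChar z x) := by
  simp_rw [Finset.sum_mul_sum, Finset.mul_sum, Finset.sum_mul]
  rw [Finset.sum_comm (s := Finset.univ (α := I → Bool)) (f := fun x y => ∑ z, q x * _)]
  refine Finset.sum_congr rfl fun y _ => ?_
  rw [Finset.sum_comm]
  refine Finset.sum_congr rfl fun x _ => Finset.sum_congr rfl fun z _ => ?_
  ring

/-- The commutator of the hypercube adjacency operator with multiplication by a polynomial of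
degree `d` bounded by `K` on the cube has bilinear form bounded by `4 * d * K`. -/
lemma cube_commutator_le [DecidableEq I] (p : MvPolynomial I ℝ) (q : (I → Bool) → ℝ) (K : ℝ)
    (hq : ∀ x : I → Bool, MvPolynomial.eval (fun i => if x i then (1 : ℝ) else 0) p = q x)
    (hK : ∀ x, |q x| ≤ K) (u v : (I → Bool) → ℝ) :
    ∑ x, ∑ i, (q x - q (cubeFlip i x)) * (u x * v (cubeFlip i x))
      ≤ 2 * p.totalDegree * K * (∑ x, u x ^ 2 + ∑ x, v x ^ 2) := by
  have hK0 : 0 ≤ K := (abs_nonneg _).trans (hK fun _ => false)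
  have hN : (0 : ℝ) < 2 ^ Fintype.card I := by positivity
  have hband : ∀ y z : I → Bool, ∑ x, cubeChar y x * cubeChar z x * q x ≠ 0 →
      cubeWeight y ≤ cubeWeight z + p.totalDegree ∧
        cubeWeight z ≤ cubeWeight y + p.totalDegree := by
    intro y z h
    simp only [← hq] at h
    have h1 := hammingDist_le_totalDegree p y z h
    have h2 := cubeWeight_le_add_hammingDist y z
    have h3 := cubeWeight_le_add_hammingDist z y
    rw [hammingDist_comm] at h3
    omega
  have hM : ∀ a b : (I → Bool) → ℝ,
      ∑ y, ∑ z, a y * (∑ x, cubeChar y x * cubeChar z x * q x) * b z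
        ≤ K * 2 ^ Fintype.card I / 2 * (∑ y, a y ^ 2 + ∑ z, b z ^ 2) := by
    intro a b
    rw [sum_sum_mul_cubeChar_mul]
    calc _ ≤ ∑ x, K / 2 *
          ((∑ y, a y * cubeChar y x) ^ 2 + (∑ z, b z * cubeChar z x) ^ 2) := by
          refine Finset.sum_le_sum fun x _ => ?_
          set s := ∑ y, a y * cubeChar y x
          set t := ∑ z, b z * cubeChar z x
          obtain ⟨h1, h2⟩ := abs_le.mp (hK x)
          nlinarith [mul_nonneg (sub_nonneg.mpr h2) (sq_nonneg (s + t)),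
            mul_nonneg (neg_le_iff_add_nonneg.mp h1) (sq_nonneg (s - t))]
      _ = _ := by
          rw [← Finset.mul_sum, Finset.sum_add_distrib, sum_sq_sum_cubeChar, sum_sq_sum_cubeChar]
          ring
  have main := banded_commutator_le cubeWeight p.totalDegree
    (fun y z => ∑ x, cubeChar y x * cubeChar z x * q x) (K * 2 ^ Fintype.card I / 2)
    (by positivity) hband hM (fun y => ∑ w, u w * cubeChar w y) (fun y => ∑ w, v w * cubeChar w y)
  have hflip : ∑ x, ∑ i, q x * (u (cubeFlip i x) * v x)
      = ∑ x, ∑ i, q (cubeFlip i x) * (u x * v (cubeFlip i x)) := by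
    rw [Finset.sum_comm, Finset.sum_comm (s := Finset.univ (α := I → Bool))]
    refine Finset.sum_congr rfl fun i _ => ?_
    rw [← sum_cubeFlip i]
    simp only [cubeFlip_cubeFlip]
  have hlhs : ∑ y, ∑ z, ((cubeWeight y : ℝ) - cubeWeight z) * ((∑ w, u w * cubeChar w y) *
        (∑ x, cubeChar y x * cubeChar z x * q x) * ∑ w, v w * cubeChar w z)
      = (2 ^ Fintype.card I) ^ 2 / 2 *
        ∑ x, ∑ i, (q x - q (cubeFlip i x)) * (u x * v (cubeFlip i x)) := by
    calc _ = ∑ y, ∑ z, (cubeWeight y * ∑ w, u w * cubeChar w y) *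
            (∑ x, cubeChar y x * cubeChar z x * q x) * (∑ w, v w * cubeChar w z)
          - ∑ y, ∑ z, (∑ w, u w * cubeChar w y) *
            (∑ x, cubeChar y x * cubeChar z x * q x) *
              (cubeWeight z * ∑ w, v w * cubeChar w z) := by
          simp only [← Finset.sum_sub_distrib]
          refine Finset.sum_congr rfl fun y _ => Finset.sum_congr rfl fun z _ => ?_
          ring
      _ = (2 ^ Fintype.card I) ^ 2 / 2 * (∑ x, ∑ i, q x * (u x * v (cubeFlip i x))
          - ∑ x, ∑ i, q x * (u (cubeFlip i x) * v x)) := by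
          rw [sum_sum_mul_cubeChar_mul, sum_sum_mul_cubeChar_mul]
          simp only [sum_cubeWeight_mul, sum_sum_cubeChar_mul]
          simp only [← Finset.sum_sub_distrib, Finset.mul_sum (s := Finset.univ (α := I → Bool))]
          refine Finset.sum_congr rfl fun x _ => ?_
          rw [Finset.sum_sub_distrib, ← Finset.mul_sum, ← Finset.mul_sum, ← Finset.mul_sum,
            ← Finset.sum_mul]
          ring
      _ = _ := by
          rw [hflip]
          simp only [← Finset.sum_sub_distrib, sub_mul]
  rw [hlhs, sum_sq_sum_cubeChar u, sum_sq_sum_cubeChar v] at main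
  refine le_of_mul_le_mul_left (a := (2 ^ Fintype.card I) ^ 2 / 2) (main.trans_eq ?_) (by positivity)
  ring

lemma hammingDist_eq_one_iff [DecidableEq I] (x y : I → Bool) :
    hammingDist x y = 1 ↔ ∃ i, cubeFlip i x = y := by
  unfold hammingDist
  rw [Finset.card_eq_one]
  refine exists_congr fun i => ?_
  constructor
  · intro h
    funext j
    have hj := Finset.ext_iff.mp h j
    simp only [Finset.mem_filter, Finset.mem_univ, true_and, Finset.mem_singleton] at hj
    by_cases hji : j = i
    · subst hji
      have := hj.mpr rfl
      revert this
      simp only [cubeFlip, Function.update_self]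
      cases x j <;> cases y j <;> simp
    · rw [cubeFlip, Function.update_of_ne hji]
      by_contra hne
      exact hji (hj.mp hne)
  · rintro rfl
    ext j
    simp only [Finset.mem_filter, Finset.mem_univ, true_and, Finset.mem_singleton]
    by_cases hji : j = i
    · subst hji
      simp [cubeFlip]
    · simp [cubeFlip, hji]

lemma sum_hammingDist_eq_one [DecidableEq I] (x : I → Bool) (g : (I → Bool) → ℝ) :
    ∑ y, (if hammingDist x y = 1 then g y else 0) = ∑ i, g (cubeFlip i x) := by
  rw [← Finset.sum_filter]
  have : Finset.univ.filter (fun y => hammingDist x y = 1)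
      = Finset.univ.image fun i => cubeFlip i x := by
    ext y
    simp [hammingDist_eq_one_iff]
  rw [this, Finset.sum_image fun i _ j _ h => cubeFlip_left_injective x h]

lemma sum_mul_sensAdj_mulVec [DecidableEq I] (f : (I → Bool) → Bool) (u v : (I → Bool) → ℝ) :
    ∑ x, u x * (sensAdj f).mulVec v x
      = ∑ x, ∑ i, if f x ≠ f (cubeFlip i x) then u x * v (cubeFlip i x) else 0 := by
  refine Finset.sum_congr rfl fun x _ => ?_
  rw [← sum_hammingDist_eq_one x fun y => if f x ≠ f y then u x * v y else 0, Matrix.mulVec,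
    dotProduct, Finset.mul_sum]
  refine Finset.sum_congr rfl fun y _ => ?_
  rw [sensAdj, Matrix.of_apply, ite_and]
  split_ifs <;> simp

lemma sum_mul_sensAdj_mulVec_le [DecidableEq I] (f : (I → Bool) → Bool) (p : MvPolynomial I ℝ)
    (hp : ∀ x : I → Bool, |MvPolynomial.eval (fun i => if x i then (1 : ℝ) else 0) p
      - (if f x then 1 else 0)| ≤ 1 / 3) (u v : (I → Bool) → ℝ) :
    ∑ x, u x * (sensAdj f).mulVec v x
      ≤ 8 * p.totalDegree * (∑ x, u x ^ 2 + ∑ x, v x ^ 2) := by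
  set q : (I → Bool) → ℝ := fun x => MvPolynomial.eval (fun i => if x i then (1 : ℝ) else 0) p
    with hq
  have hqf : ∀ x, |q x - (if f x then 1 else 0)| ≤ 1 / 3 := hp
  have hK : ∀ x, |q x| ≤ 4 / 3 := by
    intro x
    have h := abs_le.mp (hqf x)
    rw [abs_le]
    split_ifs at h <;> constructor <;> linarith
  set r : Bool → ((I → Bool) → ℝ) → (I → Bool) → ℝ := fun b w x => if f x = b then |w x| else 0
    with hr
  have h1 := cube_commutator_le p q (4 / 3) (fun _ => rfl) hK (r true u) (r false v)
  have h2 := cube_commutator_le p q (4 / 3) (fun _ => rfl) hK (fun x => -r false u x) (r true v)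
  have hsq : ∀ w : (I → Bool) → ℝ, ∑ x, w x ^ 2 = ∑ x, r true w x ^ 2 + ∑ x, r false w x ^ 2 := by
    intro w
    rw [← Finset.sum_add_distrib]
    refine Finset.sum_congr rfl fun x _ => ?_
    simp only [hr]
    cases f x <;> simp
  have hle : ∑ x, u x * (sensAdj f).mulVec v x
      ≤ 3 * (∑ x, ∑ i, (q x - q (cubeFlip i x)) * (r true u x * r false v (cubeFlip i x))
        + ∑ x, ∑ i, (q x - q (cubeFlip i x)) * (-r false u x * r true v (cubeFlip i x))) := by
    rw [sum_mul_sensAdj_mulVec]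
    simp only [← Finset.sum_add_distrib, Finset.mul_sum]
    refine Finset.sum_le_sum fun x _ => Finset.sum_le_sum fun i _ => ?_
    have hx := abs_le.mp (hqf x)
    have hy := abs_le.mp (hqf (cubeFlip i x))
    have huv : u x * v (cubeFlip i x) ≤ |u x| * |v (cubeFlip i x)| := by
      rw [← abs_mul]; exact le_abs_self _
    have hnn : 0 ≤ |u x| * |v (cubeFlip i x)| := by positivity
    simp only [hr]
    cases hfx : f x <;> cases hfy : f (cubeFlip i x) <;> simp [hfx, hfy] at hx hy ⊢ <;>
      nlinarith
  simp only [neg_sq] at h2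
  rw [hsq u, hsq v]
  linarith

end Cube

lemma specNorm_le_of_bilin_le {V : Type*} [Fintype V] [DecidableEq V] (A : Matrix V V ℝ) (c : ℝ)
    (hc : 0 ≤ c)
    (h : ∀ u v : V → ℝ, ∑ x, u x * A.mulVec v x ≤ c / 2 * (∑ x, u x ^ 2 + ∑ x, v x ^ 2)) :
    specNorm A ≤ c := by
  refine ContinuousLinearMap.opNorm_le_bound _ hc fun v => ?_
  set w := Matrix.toEuclideanCLM (𝕜 := ℝ) A v with hw
  have hwx : ∀ x, A.mulVec v x = w x := fun x => rfl
  have hv2 : ∑ x, v x ^ 2 = ‖v‖ ^ 2 := by simp [EuclideanSpace.norm_sq_eq]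
  have hw2 : ∑ x, w x ^ 2 = ‖w‖ ^ 2 := by simp [EuclideanSpace.norm_sq_eq]
  have key : ∀ t : ℝ, t * ‖w‖ ^ 2 ≤ c / 2 * (t ^ 2 * ‖w‖ ^ 2 + ‖v‖ ^ 2) := by
    intro t
    have := h (fun x => t * w x) v
    simp only [hwx, mul_pow, ← Finset.mul_sum, mul_assoc, ← sq, hv2, hw2] at this
    exact this
  refine abs_le_of_sq_le_sq' ?_ (by positivity) |>.2
  rcases hc.eq_or_lt with rfl | hpos
  · have := key 1
    simp only [zero_div, zero_mul, one_mul] at this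
    simpa using this
  · have := key (1 / c)
    have e1 : c / 2 * ((1 / c) ^ 2 * ‖w‖ ^ 2 + ‖v‖ ^ 2) = ‖w‖ ^ 2 / (2 * c) + c / 2 * ‖v‖ ^ 2 := by
      field_simp
    rw [e1] at this
    have h3 := mul_le_mul_of_nonneg_left this (by positivity : 0 ≤ 2 * c)
    have e2 : 2 * c * (1 / c * ‖w‖ ^ 2) = 2 * ‖w‖ ^ 2 := by field_simp
    have e3 : 2 * c * (‖w‖ ^ 2 / (2 * c) + c / 2 * ‖v‖ ^ 2) = ‖w‖ ^ 2 + (c * ‖v‖) ^ 2 := by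
      field_simp
    rw [e2, e3] at h3
    linarith

/-- Every Boolean function is the restriction to the cube of a real polynomial. -/
lemma exists_mvPolynomial_eval_eq {n : ℕ} (f : (Fin n → Bool) → Bool) :
    ∃ p : MvPolynomial (Fin n) ℝ, ∀ x : Fin n → Bool,
      MvPolynomial.eval (fun i => if x i then (1 : ℝ) else 0) p = if f x then 1 else 0 := by
  refine ⟨∑ a : Fin n → Bool, MvPolynomial.C (if f a then (1 : ℝ) else 0) *
    ∏ i, (if a i then MvPolynomial.X i else 1 - MvPolynomial.X i), fun x => ?_⟩
  have h : ∀ a : Fin n → Bool, ∏ i, MvPolynomial.eval (fun i => if x i then (1 : ℝ) else 0)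
      (if a i then MvPolynomial.X i else 1 - MvPolynomial.X i) = if a = x then 1 else 0 := by
    intro a
    split_ifs with hax
    · subst hax
      refine Finset.prod_eq_one fun i _ => ?_
      cases h : a i <;> simp [h]
    · obtain ⟨i, hi⟩ := Function.ne_iff.mp hax
      refine Finset.prod_eq_zero (Finset.mem_univ i) ?_
      revert hi
      cases ha : a i <;> cases hx : x i <;> simp [hx]
  simp only [map_sum, map_mul, map_prod, MvPolynomial.eval_C, h]
  simp

lemma exists_mvPolynomial_totalDegree_eq_adegB {n : ℕ} (f : (Fin n → Bool) → Bool) :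
    ∃ p : MvPolynomial (Fin n) ℝ, p.totalDegree = adegB f ∧ ∀ x : Fin n → Bool,
      |MvPolynomial.eval (fun i => if x i then (1 : ℝ) else 0) p - (if f x then 1 else 0)|
        ≤ 1 / 3 := by
  obtain ⟨p, hp⟩ := exists_mvPolynomial_eval_eq f
  refine Nat.sInf_mem (s := {d | ∃ p : MvPolynomial (Fin n) ℝ, p.totalDegree = d ∧
    ∀ x : Fin n → Bool, |MvPolynomial.eval (fun i => if x i then (1 : ℝ) else 0) p
      - (if f x then 1 else 0)| ≤ 1 / 3}) ⟨p.totalDegree, p, rfl, fun x => ?_⟩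
  rw [hp x, sub_self, abs_zero]
  norm_num

/-- The spectral sensitivity is at most a constant times the approximate degree. -/
theorem specSens_le_adegB {n : ℕ} (f : (Fin n → Bool) → Bool) : specSens f ≤ 16 * adegB f := by
  obtain ⟨p, hdeg, hp⟩ := exists_mvPolynomial_totalDegree_eq_adegB f
  refine specNorm_le_of_bilin_le _ _ (by positivity) fun u v => ?_
  rw [← hdeg]
  refine (sum_mul_sensAdj_mulVec_le f p hp u v).trans_eq ?_
  ring

/-- There is a universal constant `C > 0` such that for every `n ≥ 2` and
every total Boolean function `f : {0,1}^n → {0,1}`, `λ(f) ≤ C · adeg(f) · log n`. -/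
theorem specSens_le_adegB_log : ∃ C : ℝ, 0 < C ∧
    ∀ n : ℕ, 2 ≤ n → ∀ f : (Fin n → Bool) → Bool,
      specSens f ≤ C * (adegB f : ℝ) * Real.log n := by
  refine ⟨32, by norm_num, fun n hn f => (specSens_le_adegB f).trans ?_⟩
  have h2 : (1 / 2 : ℝ) ≤ Real.log n := by
    have h := Real.log_le_log (by norm_num) (by exact_mod_cast hn : (2 : ℝ) ≤ n)
    linarith [Real.log_two_gt_d9]
  nlinarith [mul_le_mul_of_nonneg_left h2 (Nat.cast_nonneg (α := ℝ) (adegB f))]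
end

section
/- For every n ≥ 1, every total Boolean function f : {0,1}^n → {0,1}, and every ε ∈ [0, 1/2), λ(f) ≤ adeg_ε(f) / (1 − 2ε). -/
/-- `ε`-approximate degree (two-sided, `±1` normalization): the minimum total degree of a
real polynomial `q` with `q(x) ∈ [1-2ε, 1]` when `f(x) = 1` and `q(x) ∈ [-1, -1+2ε]` when
`f(x) = 0`. -/
noncomputable def adegEps {n : ℕ} (f : (Fin n → Bool) → Bool) (ε : ℝ) : ℕ :=
  sInf {d | ∃ p : MvPolynomial (Fin n) ℝ, p.totalDegree = d ∧
    ∀ x : Fin n → Bool,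
      (f x = true →
        MvPolynomial.eval (fun i => if x i then (1 : ℝ) else 0) p ∈ Set.Icc (1 - 2 * ε) 1) ∧
      (f x = false →
        MvPolynomial.eval (fun i => if x i then (1 : ℝ) else 0) p ∈ Set.Icc (-1) (-1 + 2 * ε))}

open scoped Matrix.Norms.L2Operator

lemma specNorm_eq_l2_opNorm {I : Type*} [Fintype I] [DecidableEq I] (A : Matrix I I ℝ) :
    specNorm A = ‖A‖ := rfl

/-- The spectral norm is monotone on entrywise nonnegative matrices. -/
lemma l2_opNorm_le_of_entrywise_le {I : Type*} [Fintype I] [DecidableEq I] {A B : Matrix I I ℝ}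
    (h0 : ∀ x y, 0 ≤ A x y) (h : ∀ x y, A x y ≤ B x y) : ‖A‖ ≤ ‖B‖ := by
  rw [Matrix.l2_opNorm_def]
  refine ContinuousLinearMap.opNorm_le_bound _ (norm_nonneg _) fun v => ?_
  set w : EuclideanSpace ℝ I := WithLp.toLp 2 fun i => |v i| with hw
  have hwv : ‖w‖ = ‖v‖ := by simp [EuclideanSpace.norm_eq, hw]
  have hB := Matrix.l2_opNorm_mulVec B w
  rw [hwv] at hB
  refine le_trans ?_ hB
  rw [EuclideanSpace.norm_eq, EuclideanSpace.norm_eq]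
  refine Real.sqrt_le_sqrt (Finset.sum_le_sum fun x _ => ?_)
  refine pow_le_pow_left₀ (norm_nonneg _) ?_ 2
  change |∑ y, A x y * v y| ≤ |∑ y, B x y * w y|
  refine le_trans (Finset.abs_sum_le_sum_abs _ _) (le_trans (Finset.sum_le_sum fun y _ => ?_)
    (le_abs_self _))
  rw [abs_mul, abs_of_nonneg (h0 x y)]
  exact mul_le_mul_of_nonneg_right (h x y) (abs_nonneg _)

lemma l2_opNorm_diagonal_le_one {I : Type*} [Fintype I] [DecidableEq I] {v : I → ℝ}
    (hv : ∀ x, |v x| ≤ 1) : ‖(Matrix.diagonal v : Matrix I I ℝ)‖ ≤ 1 := by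
  rw [Matrix.l2_opNorm_diagonal]
  exact (pi_norm_le_iff_of_nonneg zero_le_one).2 hv

/-- The square wave of period `4 * d`. -/
def squareWave (d t : ℕ) : ℝ := if t % (4 * d) < 2 * d then 1 else -1

lemma squareWave_add_period (d t : ℕ) : squareWave d (t + 4 * d) = squareWave d t := by
  simp [squareWave]

lemma squareWave_mul_self (d t : ℕ) : squareWave d t * squareWave d t = 1 := by
  unfold squareWave; split_ifs <;> simp

lemma sum_range_add_of_periodic {g : ℕ → ℝ} {p : ℕ} (hg : ∀ t, g (t + p) = g t) (a : ℕ) :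
    ∑ s ∈ Finset.range p, g (s + a) = ∑ s ∈ Finset.range p, g s := by
  induction a with
  | zero => simp
  | succ a ih =>
    rw [← ih]
    have h1 := Finset.sum_range_succ (fun s => g (s + a)) p
    have h2 := Finset.sum_range_succ' (fun s => g (s + a)) p
    have h3 : g (p + a) = g (0 + a) := by rw [zero_add, add_comm, hg]
    have h4 : ∀ s, g (s + (a + 1)) = g (s + 1 + a) := fun s => by congr 1; ring
    simp only [h4]
    linarith

lemma squareWave_of_lt {d t : ℕ} (h : t < 2 * d) : squareWave d t = 1 := by
  rw [squareWave, Nat.mod_eq_of_lt (by omega), if_pos h]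

lemma squareWave_of_le_of_lt {d t : ℕ} (h : 2 * d ≤ t) (h' : t < 4 * d) :
    squareWave d t = -1 := by
  rw [squareWave, Nat.mod_eq_of_lt h', if_neg (by omega)]

lemma squareWave_of_le_of_lt_six {d t : ℕ} (h : 4 * d ≤ t) (h' : t < 6 * d) :
    squareWave d t = 1 := by
  obtain ⟨s, rfl⟩ := Nat.exists_eq_add_of_le' h
  rw [squareWave_add_period, squareWave_of_lt (by omega)]

/-- The autocorrelation of the square wave is a triangle wave. -/
lemma sum_squareWave_mul_squareWave_add {d k : ℕ} (hk : k ≤ 2 * d) :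
    ∑ s ∈ Finset.range (4 * d), squareWave d s * squareWave d (s + k) = 4 * d - 4 * k := by
  obtain ⟨p, hp⟩ := Nat.exists_eq_add_of_le' hk
  have hd : 4 * d = p + k + p + k := by omega
  rw [hd, Finset.sum_range_add, Finset.sum_range_add, Finset.sum_range_add]
  have e1 : ∑ s ∈ Finset.range p, squareWave d s * squareWave d (s + k) = p := by
    rw [Finset.sum_congr rfl (g := fun _ => (1 : ℝ))]
    · simp
    · intro s hs
      rw [Finset.mem_range] at hs
      rw [squareWave_of_lt (by omega), squareWave_of_lt (by omega), one_mul]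
  have e2 : ∑ s ∈ Finset.range k, squareWave d (p + s) * squareWave d (p + s + k) = -k := by
    rw [Finset.sum_congr rfl (g := fun _ => (-1 : ℝ))]
    · simp
    · intro s hs
      rw [Finset.mem_range] at hs
      rw [squareWave_of_lt (by omega), squareWave_of_le_of_lt (by omega) (by omega), one_mul]
  have e3 : ∑ s ∈ Finset.range p,
      squareWave d (p + k + s) * squareWave d (p + k + s + k) = p := by
    rw [Finset.sum_congr rfl (g := fun _ => (1 : ℝ))]
    · simp
    · intro s hs
      rw [Finset.mem_range] at hs
      rw [squareWave_of_le_of_lt (by omega) (by omega),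
        squareWave_of_le_of_lt (by omega) (by omega)]
      norm_num
  have e4 : ∑ s ∈ Finset.range k,
      squareWave d (p + k + p + s) * squareWave d (p + k + p + s + k) = -k := by
    rw [Finset.sum_congr rfl (g := fun _ => (-1 : ℝ))]
    · simp
    · intro s hs
      rw [Finset.mem_range] at hs
      rw [squareWave_of_le_of_lt (by omega) (by omega),
        squareWave_of_le_of_lt_six (by omega) (by omega), mul_one]
  rw [e1, e2, e3, e4]
  have hd' : (4 * d : ℝ) = p + k + p + k := mod_cast hd
  linarith

lemma sum_squareWave_mul_squareWave {d a b : ℕ} (hab : a ≤ b + d) (hba : b ≤ a + d) :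
    ∑ s ∈ Finset.range (4 * d), squareWave d (s + a) * squareWave d (s + (b + d)) =
      4 * ((a : ℝ) - b) := by
  obtain ⟨k, hk⟩ := Nat.exists_eq_add_of_le hab
  have h := sum_range_add_of_periodic (p := 4 * d)
    (g := fun s => squareWave d s * squareWave d (s + k))
    (fun t => by
      rw [squareWave_add_period, show t + 4 * d + k = t + k + 4 * d by ring,
        squareWave_add_period]) a
  rw [sum_squareWave_mul_squareWave_add (by omega)] at h
  simp only [add_assoc] at h
  rw [hk, h]
  have hk' : (b : ℝ) + d = a + k := mod_cast hk
  linarith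

/-- The Walsh–Hadamard matrix. -/
def walsh (I : Type*) [Fintype I] : Matrix (I → Bool) (I → Bool) ℝ :=
  Matrix.of fun x y => ∏ i, if x i && y i then (-1 : ℝ) else 1

lemma walsh_comm {I : Type*} [Fintype I] (x y : I → Bool) : walsh I x y = walsh I y x := by
  simp only [walsh, Matrix.of_apply, Bool.and_comm]

lemma walsh_transpose {I : Type*} [Fintype I] : (walsh I).transpose = walsh I := by
  ext x y
  exact walsh_comm y x

lemma walsh_mul_self_apply {I : Type*} [Fintype I] (x y : I → Bool) :
    walsh I x y * walsh I x y = 1 := by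
  simp only [walsh, Matrix.of_apply, ← Finset.prod_mul_distrib]
  exact Finset.prod_eq_one fun i _ => by split_ifs <;> simp

section Cube

variable {I : Type*} [DecidableEq I]

/-- Flip the `i`-th coordinate. -/
def flipAt (i : I) (x : I → Bool) : I → Bool := Function.update x i (!x i)

lemma flipAt_involutive (i : I) : Function.Involutive (flipAt i) := by
  intro x; simp [flipAt]

lemma flipAt_of_ne {i j : I} (h : j ≠ i) (x : I → Bool) : flipAt i x j = x j := by
  simp [flipAt, h]

variable [Fintype I]

lemma sum_eq_zero_of_flipAt (i : I) {g : (I → Bool) → ℝ} (hg : ∀ x, g (flipAt i x) = -g x) :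
    ∑ x, g x = 0 := by
  have h := Equiv.sum_comp (flipAt_involutive i).toPerm g
  simp only [Function.Involutive.coe_toPerm, hg, Finset.sum_neg_distrib] at h
  linarith

lemma walsh_flipAt (i : I) (x y : I → Bool) :
    walsh I (flipAt i x) y = (if y i then -1 else 1) * walsh I x y := by
  simp only [walsh, Matrix.of_apply]
  rw [← Finset.mul_prod_erase _ _ (Finset.mem_univ i),
    ← Finset.mul_prod_erase _ _ (Finset.mem_univ i), ← mul_assoc]
  congr 1
  · cases hx : x i <;> cases hy : y i <;> simp [flipAt, hx]
  · exact Finset.prod_congr rfl fun j hj => by rw [flipAt_of_ne (Finset.ne_of_mem_erase hj)]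

lemma walsh_mul_walsh :
    walsh I * walsh I = (Fintype.card (I → Bool) : ℝ) • (1 : Matrix (I → Bool) (I → Bool) ℝ) := by
  ext x z
  rw [Matrix.mul_apply, Matrix.smul_apply, smul_eq_mul]
  by_cases h : x = z
  · subst h
    simp [walsh_comm _ x, walsh_mul_self_apply]
  · rw [Matrix.one_apply_ne h, mul_zero]
    obtain ⟨i, hi⟩ := Function.ne_iff.1 h
    refine sum_eq_zero_of_flipAt i fun y => ?_
    rw [walsh_comm x, walsh_comm x, walsh_flipAt, walsh_flipAt]
    cases hx : x i <;> cases hz : z i <;> simp_all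

/-- Adjacency matrix of the hypercube. -/
def cubeAdj (I : Type*) [Fintype I] [DecidableEq I] : Matrix (I → Bool) (I → Bool) ℝ :=
  Matrix.of fun x y => ∑ i, if flipAt i x = y then 1 else 0

lemma cubeAdj_nonneg (x y : I → Bool) : 0 ≤ cubeAdj I x y :=
  Finset.sum_nonneg fun i _ => by split_ifs <;> simp

lemma one_le_cubeAdj {x y : I → Bool} (h : hammingDist x y = 1) : 1 ≤ cubeAdj I x y := by
  obtain ⟨i, hi⟩ := Finset.card_eq_one.1 h
  have hj : ∀ j, x j ≠ y j ↔ j = i := fun j => by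
    rw [← Finset.mem_singleton, ← hi, Finset.mem_filter]; simp
  have hxy : flipAt i x = y := by
    ext1 j
    by_cases h : j = i
    · subst h
      have := (hj j).2 rfl
      cases hx : x j <;> cases hy : y j <;> simp_all [flipAt]
    · rw [flipAt_of_ne h]
      exact not_not.1 fun hne => h ((hj j).1 hne)
  calc (1 : ℝ) = if flipAt i x = y then 1 else 0 := by rw [if_pos hxy]
    _ ≤ cubeAdj I x y := Finset.single_le_sum (f := fun i => if flipAt i x = y then (1 : ℝ) else 0)
        (fun j _ => by split_ifs <;> simp) (Finset.mem_univ i)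

/-- Hamming weight. -/
def weight (x : I → Bool) : ℕ := (Finset.univ.filter fun i => x i = true).card

lemma cubeAdj_mul_walsh : cubeAdj I * walsh I =
    walsh I * Matrix.diagonal fun S => (Fintype.card I : ℝ) - 2 * weight S := by
  ext x S
  rw [Matrix.mul_diagonal, Matrix.mul_apply]
  simp only [cubeAdj, Matrix.of_apply, Finset.sum_mul]
  rw [Finset.sum_comm]
  simp only [ite_mul, one_mul, zero_mul, Finset.sum_ite_eq, Finset.mem_univ, if_true, walsh_flipAt]
  have h : ∀ i, (if S i then -1 * walsh I x S else walsh I x S) =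
      walsh I x S * (1 - 2 * if S i then 1 else 0) := fun i => by split_ifs <;> ring
  simp only [h, ← Finset.mul_sum, Finset.sum_sub_distrib, weight]
  simp

lemma cubeAdj_transpose : (cubeAdj I).transpose = cubeAdj I := by
  ext x y
  refine Finset.sum_congr rfl fun i _ => ?_
  simp only [(flipAt_involutive i).eq_iff, eq_comm (a := x)]

lemma walsh_mul_cubeAdj : walsh I * cubeAdj I =
    (Matrix.diagonal fun S => (Fintype.card I : ℝ) - 2 * weight S) * walsh I := by
  have h := congrArg Matrix.transpose (cubeAdj_mul_walsh (I := I))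
  rwa [Matrix.transpose_mul, Matrix.transpose_mul, Matrix.diagonal_transpose, walsh_transpose,
    cubeAdj_transpose] at h

lemma weight_le_add_card_ne (S T : I → Bool) :
    weight S ≤ weight T + (Finset.univ.filter fun i => S i ≠ T i).card := by
  refine le_trans (Finset.card_le_card ?_) (Finset.card_union_le _ _)
  intro i
  simp only [Finset.mem_filter, Finset.mem_univ, true_and, Finset.mem_union]
  intro h
  cases hT : T i <;> simp [h]

/-- The value of a polynomial at a Boolean point. -/
noncomputable def boolEval (p : MvPolynomial I ℝ) (x : I → Bool) : ℝ :=
  MvPolynomial.eval (fun i => if x i then (1 : ℝ) else 0) p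

lemma sum_walsh_mul_boolEval_mul_walsh_eq_zero (p : MvPolynomial I ℝ) {S T : I → Bool}
    (h : p.totalDegree < (Finset.univ.filter fun i => S i ≠ T i).card) :
    ∑ x, walsh I S x * boolEval p x * walsh I x T = 0 := by
  simp only [boolEval, MvPolynomial.eval_eq', Finset.mul_sum, Finset.sum_mul]
  rw [Finset.sum_comm]
  refine Finset.sum_eq_zero fun m hm => ?_
  have hcard : m.support.card < (Finset.univ.filter fun i => S i ≠ T i).card := by
    refine lt_of_le_of_lt ?_ h
    refine le_trans ?_ (MvPolynomial.le_totalDegree hm)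
    rw [Finsupp.sum, Finset.card_eq_sum_ones]
    exact Finset.sum_le_sum fun i hi => Nat.one_le_iff_ne_zero.2 (Finsupp.mem_support_iff.1 hi)
  obtain ⟨i, hi, him⟩ := Finset.exists_mem_notMem_of_card_lt_card hcard
  have hm0 : m i = 0 := Finsupp.notMem_support_iff.1 him
  have hST : S i ≠ T i := (Finset.mem_filter.1 hi).2
  refine sum_eq_zero_of_flipAt i fun x => ?_
  have hprod : ∏ j, (if flipAt i x j then (1 : ℝ) else 0) ^ m j =
      ∏ j, (if x j then (1 : ℝ) else 0) ^ m j := by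
    refine Finset.prod_congr rfl fun j _ => ?_
    by_cases hj : j = i
    · rw [hj, hm0, pow_zero, pow_zero]
    · rw [flipAt_of_ne hj]
  rw [hprod, walsh_comm S, walsh_comm S, walsh_flipAt, walsh_flipAt]
  cases hS : S i <;> cases hT : T i <;> simp_all

/-- The reflection acting as `squareWave d (s + ·)` on the levels of the Fourier basis. -/
noncomputable def levelReflection (I : Type*) [Fintype I] [DecidableEq I] (d s : ℕ) :
    Matrix (I → Bool) (I → Bool) ℝ :=
  (Fintype.card (I → Bool) : ℝ)⁻¹ •
    (walsh I * (Matrix.diagonal fun S => squareWave d (s + weight S)) * walsh I)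

lemma walsh_mul_walsh_mul (B : Matrix (I → Bool) (I → Bool) ℝ) :
    walsh I * (walsh I * B) = (Fintype.card (I → Bool) : ℝ) • B := by
  rw [← mul_assoc, walsh_mul_walsh, smul_mul_assoc, one_mul]

lemma card_cube_ne_zero : (Fintype.card (I → Bool) : ℝ) ≠ 0 := by
  exact_mod_cast Fintype.card_ne_zero

lemma norm_levelReflection_le_one (d s : ℕ) : ‖levelReflection I d s‖ ≤ 1 := by
  have hN := card_cube_ne_zero (I := I)
  refine (CStarRing.norm_of_mem_unitary ?_).le
  have hstar : star (levelReflection I d s) = levelReflection I d s := by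
    rw [levelReflection, Matrix.star_eq_conjTranspose, Matrix.conjTranspose_eq_transpose_of_trivial,
      Matrix.transpose_smul, Matrix.transpose_mul, Matrix.transpose_mul, walsh_transpose,
      Matrix.diagonal_transpose, mul_assoc]
  have hsq : levelReflection I d s * levelReflection I d s = 1 := by
    simp only [levelReflection, smul_mul_assoc, mul_smul_comm, mul_assoc, walsh_mul_walsh_mul]
    rw [← mul_assoc (Matrix.diagonal _) (Matrix.diagonal _), Matrix.diagonal_mul_diagonal]
    simp only [squareWave_mul_self, Matrix.diagonal_one, one_mul, walsh_mul_walsh, smul_smul]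
    rw [show ∀ a : ℝ, a = 1 → a • (1 : Matrix (I → Bool) (I → Bool) ℝ) = 1 from
      fun a ha => by rw [ha, one_smul]]
    field_simp
  rw [Unitary.mem_iff, hstar, hsq]
  exact ⟨rfl, rfl⟩

lemma commutator_cubeAdj_diagonal (p : MvPolynomial I ℝ) :
    cubeAdj I * Matrix.diagonal (boolEval p) - Matrix.diagonal (boolEval p) * cubeAdj I =
      (1 / 2 : ℝ) • ∑ s ∈ Finset.range (4 * p.totalDegree),
        levelReflection I p.totalDegree (s + p.totalDegree) * Matrix.diagonal (boolEval p) *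
          levelReflection I p.totalDegree s := by
  set d := p.totalDegree with hd
  set Q := Matrix.diagonal (boolEval p) with hQ
  set N : ℝ := (Fintype.card (I → Bool) : ℝ) with hN
  have hN0 : N ≠ 0 := card_cube_ne_zero
  set E := walsh I * Q * walsh I with hE
  set L : Matrix (I → Bool) (I → Bool) ℝ :=
    Matrix.diagonal fun S => (Fintype.card I : ℝ) - 2 * weight S with hL
  have hQE : Q = (N⁻¹ * N⁻¹) • (walsh I * E * walsh I) := by
    rw [hE]
    simp only [mul_assoc, walsh_mul_walsh_mul, walsh_mul_walsh, smul_mul_assoc, mul_smul_comm,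
      mul_one, smul_smul, ← hN]
    rw [show N⁻¹ * (N⁻¹ * (N * N)) = 1 by field_simp, one_smul]
  have hfourier : L * E - E * L = (1 / 2 : ℝ) • ∑ s ∈ Finset.range (4 * d),
      (Matrix.diagonal fun S => squareWave d (s + d + weight S)) * E *
        (Matrix.diagonal fun S => squareWave d (s + weight S)) := by
    ext S T
    have hEST : E S T = ∑ x, walsh I S x * boolEval p x * walsh I x T := by
      rw [hE, hQ, Matrix.mul_apply]
      simp only [Matrix.mul_diagonal]
    simp only [Matrix.sub_apply, hL, Matrix.diagonal_mul, Matrix.mul_diagonal, Matrix.smul_apply,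
      Matrix.sum_apply, smul_eq_mul]
    by_cases hdeg : d < (Finset.univ.filter fun i => S i ≠ T i).card
    · rw [hEST, sum_walsh_mul_boolEval_mul_walsh_eq_zero p hdeg]
      simp
    · have h1 := weight_le_add_card_ne S T
      have h2 := weight_le_add_card_ne T S
      simp only [ne_comm (a := T _)] at h2
      have h3 := sum_squareWave_mul_squareWave (d := d) (a := weight T) (b := weight S)
        (by omega) (by omega)
      have h4 : ∀ s, squareWave d (s + d + weight S) * E S T * squareWave d (s + weight T) =
          squareWave d (s + weight T) * squareWave d (s + (weight S + d)) * E S T := fun s => by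
        rw [show s + d + weight S = s + (weight S + d) by ring]; ring
      simp only [h4, ← Finset.sum_mul, h3]
      ring
  have hleft : cubeAdj I * Q - Q * cubeAdj I =
      (N⁻¹ * N⁻¹) • (walsh I * (L * E - E * L) * walsh I) := by
    conv_lhs => rw [hQE]
    rw [mul_smul_comm, smul_mul_assoc, ← smul_sub, mul_sub, sub_mul]
    congr 2
    · rw [← mul_assoc, ← mul_assoc, cubeAdj_mul_walsh, mul_assoc (walsh I) L E]
    · rw [mul_assoc, walsh_mul_cubeAdj]; simp only [mul_assoc, hL]
  rw [hleft, hfourier]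
  simp only [levelReflection, mul_smul_comm, smul_mul_assoc, Finset.mul_sum, Finset.sum_mul,
    Finset.smul_sum, smul_smul, hE, mul_assoc, ← hN]
  refine Finset.sum_congr rfl fun s _ => ?_
  congr 1
  ring

lemma norm_commutator_le (p : MvPolynomial I ℝ) (hp : ∀ x, |boolEval p x| ≤ 1) :
    ‖cubeAdj I * Matrix.diagonal (boolEval p) - Matrix.diagonal (boolEval p) * cubeAdj I‖ ≤
      2 * p.totalDegree := by
  rw [commutator_cubeAdj_diagonal, norm_smul]
  have h : ‖∑ s ∈ Finset.range (4 * p.totalDegree),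
        levelReflection I p.totalDegree (s + p.totalDegree) * Matrix.diagonal (boolEval p) *
          levelReflection I p.totalDegree s‖ ≤ ∑ s ∈ Finset.range (4 * p.totalDegree), (1 : ℝ) := by
    refine norm_sum_le_of_le _ fun s _ => ?_
    refine (norm_mul_le _ _).trans (mul_le_one₀ ((norm_mul_le _ _).trans (mul_le_one₀ ?_ ?_ ?_))
      (norm_nonneg _) ?_)
    · exact norm_levelReflection_le_one _ _
    · exact norm_nonneg _
    · exact l2_opNorm_diagonal_le_one hp
    · exact norm_levelReflection_le_one _ _
  rw [Finset.sum_const, Finset.card_range, nsmul_eq_mul, mul_one] at h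
  push_cast at h
  rw [Real.norm_of_nonneg (by norm_num)]
  linarith

lemma specSens_mul_le (f : (I → Bool) → Bool) (p : MvPolynomial I ℝ) {δ : ℝ} (hδ : 0 < δ)
    (hp : ∀ x, |boolEval p x| ≤ 1) (h1 : ∀ x, f x = true → δ ≤ boolEval p x)
    (h0 : ∀ x, f x = false → boolEval p x ≤ -δ) :
    δ * specSens f ≤ p.totalDegree := by
  set C := cubeAdj I * Matrix.diagonal (boolEval p) - Matrix.diagonal (boolEval p) * cubeAdj I
    with hC
  set F : Matrix (I → Bool) (I → Bool) ℝ :=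
    Matrix.diagonal fun x => if f x then (-1 : ℝ) else 1 with hF
  have hFn : ‖F‖ ≤ 1 := l2_opNorm_diagonal_le_one fun x => by split_ifs <;> simp
  have hCn : ‖C‖ ≤ 2 * p.totalDegree := norm_commutator_le p hp
  have hentry : ∀ x y, C x y = cubeAdj I x y * (boolEval p y - boolEval p x) := fun x y => by
    rw [hC, Matrix.sub_apply, Matrix.mul_diagonal, Matrix.diagonal_mul]; ring
  have hbound : ‖F * C - C * F‖ ≤ 4 * p.totalDegree := by
    have := norm_sub_le (F * C) (C * F)
    have := norm_mul_le F C
    have := norm_mul_le C F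
    nlinarith [norm_nonneg C, norm_nonneg F]
  have hle : ‖(4 * δ) • sensAdj f‖ ≤ ‖F * C - C * F‖ := by
    refine l2_opNorm_le_of_entrywise_le (fun x y => ?_) fun x y => ?_
    · simp only [sensAdj, Matrix.smul_apply, Matrix.of_apply, smul_eq_mul]
      split_ifs <;> linarith
    · have hA := cubeAdj_nonneg x y
      simp only [sensAdj, Matrix.smul_apply, Matrix.of_apply, smul_eq_mul, Matrix.sub_apply, hF,
        Matrix.mul_diagonal, Matrix.diagonal_mul, hentry]
      cases hx : f x <;> cases hy : f y <;> simp
      · have hd : 2 * δ ≤ boolEval p y - boolEval p x := by linarith [h0 x hx, h1 y hy]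
        split_ifs with hh
        · nlinarith [one_le_cubeAdj hh]
        · nlinarith
      · have hd : 2 * δ ≤ boolEval p x - boolEval p y := by linarith [h1 x hx, h0 y hy]
        split_ifs with hh
        · nlinarith [one_le_cubeAdj hh]
        · nlinarith
  rw [norm_smul, Real.norm_of_nonneg (by linarith)] at hle
  rw [specSens, specNorm_eq_l2_opNorm]
  linarith

/-- Every real function on the cube is represented by a polynomial. -/
lemma exists_boolEval_eq (g : (I → Bool) → ℝ) :
    ∃ p : MvPolynomial I ℝ, ∀ x, boolEval p x = g x := by
  refine ⟨∑ a, MvPolynomial.C (g a) *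
    ∏ i, (if a i then MvPolynomial.X i else 1 - MvPolynomial.X i), fun x => ?_⟩
  simp only [boolEval, map_sum, map_mul, MvPolynomial.eval_C, map_prod]
  rw [Finset.sum_eq_single x]
  · rw [Finset.prod_eq_one, mul_one]
    intro i _
    cases hx : x i <;> simp [hx]
  · intro a _ ha
    obtain ⟨i, hi⟩ := Function.ne_iff.1 ha
    rw [Finset.prod_eq_zero (Finset.mem_univ i), mul_zero]
    cases hx : x i <;> cases hai : a i <;> simp_all
  · simp

end Cube

/-- For every `n ≥ 1`, every total Boolean function `f : {0,1}^n → {0,1}`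
and every `ε ∈ [0, 1/2)`, `λ(f) ≤ adeg_ε(f) / (1 - 2ε)`. -/
theorem specSens_le_adegEps (n : ℕ) (hn : 1 ≤ n) (f : (Fin n → Bool) → Bool)
    (ε : ℝ) (hε0 : 0 ≤ ε) (hε : ε < 1/2) :
    specSens f ≤ (adegEps f ε : ℝ) / (1 - 2 * ε) := by
  have hδ : 0 < 1 - 2 * ε := by linarith
  obtain ⟨g, hg⟩ := exists_boolEval_eq fun x => if f x then (1 : ℝ) else -1
  have hgx (x : Fin n → Bool) :
      MvPolynomial.eval (fun i => if x i then (1 : ℝ) else 0) g = if f x then (1 : ℝ) else -1 :=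
    hg x
  obtain ⟨p, hpd, hp⟩ : adegEps f ε ∈ _ := Nat.sInf_mem ⟨_, g, rfl, fun x => by
    rw [hgx x]
    cases f x <;> simp [hε0]⟩
  rw [← hpd, le_div_iff₀ hδ, mul_comm]
  refine specSens_mul_le f p hδ (fun x => abs_le.2 ?_) (fun x hx => ((hp x).1 hx).1)
    fun x hx => ?_
  · rw [boolEval]
    cases hx : f x
    · have h := (hp x).2 hx
      exact ⟨h.1, by linarith [h.2]⟩
    · have h := (hp x).1 hx
      exact ⟨by linarith [h.1], h.2⟩
  · rw [boolEval]
    linarith [((hp x).2 hx).2]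
end
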